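/- arXiv:1208.6561 — 4 statements merged into one kernel-verified Lean document; each statement's English description precedes it below -/
import Mathlib

section
/- Let n ≥ 1, k ≥ 1, a ∈ ℝⁿ, and let ψ₁, ψ₂ : ℝⁿ → ℝⁿ be C^∞ maps each having identity k-jet at a (i.e., ψᵢ(a) = a, fderiv ℝ ψᵢ a is the identity continuous linear map, and iteratedFDeriv ℝ j ψᵢ a = 0 for all 2 ≤ j ≤ k). Then the composition ψ₁ ∘ ψ₂ also has identity k-jet at a. -/
/-- `ψ` has identity `k`-jet at `a`. -/
def HasIdentityKJet {n : ℕ} (k : ℕ) (ψ : (Fin n → ℝ) → (Fin n → ℝ)) (a : Fin n → ℝ) : Prop :=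
  ψ a = a ∧ fderiv ℝ ψ a = ContinuousLinearMap.id ℝ (Fin n → ℝ) ∧
    ∀ j : ℕ, 2 ≤ j → j ≤ k → iteratedFDeriv ℝ j ψ a = 0

namespace OrderedFinpartition

theorem two_le_partSize_of_length_eq_one {j : ℕ} (hj : 2 ≤ j) (c : OrderedFinpartition j)
    (hc : c.length = 1) (m : Fin c.length) : 2 ≤ c.partSize m := by
  have hcard : ∑ i, c.partSize i = j := by
    simpa using Fintype.card_congr c.equivSigma
  have hsub : Subsingleton (Fin c.length) := by rw [hc]; infer_instance
  rw [Fintype.sum_subsingleton _ m] at hcard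
  omega

end OrderedFinpartition

/-- If the derivatives of orders `2, …, j` of `g` and `f` vanish at `f x` and `x` respectively, then
the `j`-th derivative of `g ∘ f` vanishes at `x`. -/
theorem iteratedFDeriv_comp_eq_zero {𝕜 E F G : Type*} [NontriviallyNormedField 𝕜]
    [NormedAddCommGroup E] [NormedSpace 𝕜 E] [NormedAddCommGroup F] [NormedSpace 𝕜 F]
    [NormedAddCommGroup G] [NormedSpace 𝕜 G] {g : F → G} {f : E → F} {x : E} {j : ℕ}
    (hj : 2 ≤ j) (hg : ContDiffAt 𝕜 j g (f x)) (hf : ContDiffAt 𝕜 j f x)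
    (hg0 : ∀ i, 2 ≤ i → i ≤ j → iteratedFDeriv 𝕜 i g (f x) = 0)
    (hf0 : ∀ i, 2 ≤ i → i ≤ j → iteratedFDeriv 𝕜 i f x = 0) :
    iteratedFDeriv 𝕜 j (g ∘ f) x = 0 := by
  rw [iteratedFDeriv_comp hg hf le_rfl]
  refine Finset.sum_eq_zero fun c _ => ?_
  ext v
  simp only [FormalMultilinearSeries.compAlongOrderedFinpartition_apply, ftaylorSeries,
    zero_apply]
  have hpos : 0 < c.length := c.length_pos (by omega)
  obtain hc | hc : 2 ≤ c.length ∨ c.length = 1 := by omega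
  · rw [hg0 _ hc c.length_le, zero_apply]
  · refine ContinuousMultilinearMap.map_coord_zero _ ⟨0, hpos⟩ ?_
    simp [OrderedFinpartition.applyOrderedFinpartition_apply,
      hf0 _ (c.two_le_partSize_of_length_eq_one hj hc _) (c.partSize_le _)]

/-- Section 4.1: the set of maps with identity `k`-jet at `a` is closed under composition. -/
theorem stmt2 {n k : ℕ} (hn : 1 ≤ n) (hk : 1 ≤ k) (a : Fin n → ℝ)
    (ψ₁ ψ₂ : (Fin n → ℝ) → (Fin n → ℝ))
    (hψ₁ : ContDiff ℝ (⊤ : ℕ∞) ψ₁) (hψ₂ : ContDiff ℝ (⊤ : ℕ∞) ψ₂)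
    (hjet₁ : HasIdentityKJet k ψ₁ a) (hjet₂ : HasIdentityKJet k ψ₂ a) :
    HasIdentityKJet k (ψ₁ ∘ ψ₂) a := by
  obtain ⟨h₁a, h₁d, h₁j⟩ := hjet₁
  obtain ⟨h₂a, h₂d, h₂j⟩ := hjet₂
  refine ⟨by simp [h₁a, h₂a], ?_, fun j hj hjk => ?_⟩
  · rw [fderiv_comp a (hψ₁.differentiable (by simp) _) (hψ₂.differentiable (by simp) _), h₂a,
      h₁d, h₂d, ContinuousLinearMap.id_comp]
  · have hle : (j : WithTop ℕ∞) ≤ ((⊤ : ℕ∞) : WithTop ℕ∞) := by exact_mod_cast le_top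
    refine iteratedFDeriv_comp_eq_zero hj (hψ₁.of_le hle).contDiffAt
      (hψ₂.of_le hle).contDiffAt (fun i hi hij => ?_) fun i hi hij => h₂j i hi (hij.trans hjk)
    rw [h₂a]
    exact h₁j i hi (hij.trans hjk)
end

section
/- Let n ≥ 1, let φ : ℝ × ℝ × ℝⁿ → ℝⁿ be C^∞, and let u, v : ℝ × ℝ × ℝⁿ → ℝⁿ be C^∞ maps such that for all (s,t,x): ∂φ/∂t(s,t,x) = u(s,t,φ(s,t,x)) and ∂φ/∂s(s,t,x) = v(s,t,φ(s,t,x)). Then for all (s,t,x), writing y = φ(s,t,x), one has ∂u/∂s(s,t,y) = ∂v/∂t(s,t,y) + (fderiv ℝ (v(s,t,·)) y)(u(s,t,y)) − (fderiv ℝ (u(s,t,·)) y)(v(s,t,y)). -/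
/-- The total derivative of a time-dependent map along a curve. -/
theorem hasDerivAt_comp_curve {E F : Type*} [NormedAddCommGroup E] [NormedSpace ℝ E]
    [NormedAddCommGroup F] [NormedSpace ℝ F] {w : ℝ → E → F} {c : ℝ → E} {c' : E} {r : ℝ}
    (hw : DifferentiableAt ℝ (fun p : ℝ × E => w p.1 p.2) (r, c r)) (hc : HasDerivAt c c' r) :
    HasDerivAt (fun r' => w r' (c r'))
      (deriv (fun r' => w r' (c r)) r + fderiv ℝ (w r) (c r) c') r := by
  obtain ⟨L, hL⟩ := hw
  have htime : HasDerivAt (fun r' => w r' (c r)) (L (1, 0)) r :=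
    HasFDerivAt.comp_hasDerivAt (f := fun r' => (r', c r)) r hL
      ((hasDerivAt_id r).prodMk (hasDerivAt_const r (c r)))
  have hspace : HasFDerivAt (w r) (L.comp (ContinuousLinearMap.inr ℝ ℝ E)) (c r) :=
    HasFDerivAt.comp (f := fun y => (r, y)) (c r) hL (hasFDerivAt_prodMk_right r (c r))
  have htotal : HasDerivAt (fun r' => w r' (c r')) (L (1, c')) r :=
    HasFDerivAt.comp_hasDerivAt (f := fun r' => (r', c r')) r hL ((hasDerivAt_id r).prodMk hc)
  rw [htime.deriv, hspace.fderiv]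
  convert htotal using 1
  simp [← map_add]

/-- The mixed partial derivatives of a `C²` map of two real variables agree. -/
theorem deriv_deriv_comm_of_contDiff {F : Type*} [NormedAddCommGroup F] [NormedSpace ℝ F]
    {f : ℝ → ℝ → F} (hf : ContDiff ℝ 2 (fun p : ℝ × ℝ => f p.1 p.2)) (s t : ℝ) :
    deriv (fun s' => deriv (fun t' => f s' t') t) s =
      deriv (fun t' => deriv (fun s' => f s' t') s) t := by
  set g : ℝ × ℝ → F := fun p => f p.1 p.2
  have hg1 : ∀ p, HasFDerivAt g (fderiv ℝ g p) p := fun p =>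
    (hf.differentiable (by norm_num) p).hasFDerivAt
  have hg2 : HasFDerivAt (fderiv ℝ g) (fderiv ℝ (fderiv ℝ g) (s, t)) (s, t) :=
    ((hf.fderiv_right (m := 1) (by norm_num)).differentiable (by norm_num) _).hasFDerivAt
  have hfst (a b : ℝ) : HasDerivAt (fun a' => (a', b)) ((1 : ℝ), (0 : ℝ)) a :=
    (hasDerivAt_id a).prodMk (hasDerivAt_const a b)
  have hsnd (a b : ℝ) : HasDerivAt (fun b' => (a, b')) ((0 : ℝ), (1 : ℝ)) b :=
    (hasDerivAt_const b a).prodMk (hasDerivAt_id b)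
  have hpt (a b : ℝ) : deriv (fun b' => f a b') b = fderiv ℝ g (a, b) (0, 1) :=
    (HasFDerivAt.comp_hasDerivAt (f := fun b' => (a, b')) b (hg1 (a, b)) (hsnd a b)).deriv
  have hps (a b : ℝ) : deriv (fun a' => f a' b) a = fderiv ℝ g (a, b) (1, 0) :=
    (HasFDerivAt.comp_hasDerivAt (f := fun a' => (a', b)) a (hg1 (a, b)) (hfst a b)).deriv
  have hst : HasDerivAt (fun s' => fderiv ℝ g (s', t)) (fderiv ℝ (fderiv ℝ g) (s, t) (1, 0)) s :=
    HasFDerivAt.comp_hasDerivAt (f := fun s' => (s', t)) s hg2 (hfst s t)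
  have hts : HasDerivAt (fun t' => fderiv ℝ g (s, t')) (fderiv ℝ (fderiv ℝ g) (s, t) (0, 1)) t :=
    HasFDerivAt.comp_hasDerivAt (f := fun t' => (s, t')) t hg2 (hsnd s t)
  simp only [hpt, hps]
  rw [(hst.clm_apply (hasDerivAt_const s _)).deriv, (hts.clm_apply (hasDerivAt_const t _)).deriv]
  simpa using second_derivative_symmetric hg1 hg2 (1, 0) (0, 1)

/-- The Lin constraints (Appendix, eq. (lin)): if a two-parameter family `φ(s,t,·)` of maps of
`ℝⁿ` has spatial `t`-velocity `u(s,t,·)` and spatial `s`-velocity `v(s,t,·)`, then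
`∂u/∂s = ∂v/∂t + (Dv)(u) − (Du)(v)` along the family. -/
theorem stmt6 {n : ℕ} (hn : 1 ≤ n)
    (φ u v : ℝ → ℝ → (Fin n → ℝ) → (Fin n → ℝ))
    (hφ : ContDiff ℝ (⊤ : ℕ∞) (fun p : ℝ × ℝ × (Fin n → ℝ) => φ p.1 p.2.1 p.2.2))
    (hu : ContDiff ℝ (⊤ : ℕ∞) (fun p : ℝ × ℝ × (Fin n → ℝ) => u p.1 p.2.1 p.2.2))
    (hv : ContDiff ℝ (⊤ : ℕ∞) (fun p : ℝ × ℝ × (Fin n → ℝ) => v p.1 p.2.1 p.2.2))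
    (ht : ∀ s t x, deriv (fun t' => φ s t' x) t = u s t (φ s t x))
    (hs : ∀ s t x, deriv (fun s' => φ s' t x) s = v s t (φ s t x)) :
    ∀ s t x, ∀ y, y = φ s t x →
      deriv (fun s' => u s' t y) s =
        deriv (fun t' => v s t' y) t
          + (fderiv ℝ (v s t) y) (u s t y) - (fderiv ℝ (u s t) y) (v s t y) := by
  rintro s t x _ rfl
  have hφs : HasDerivAt (fun s' => φ s' t x) (v s t (φ s t x)) s := by
    rw [← hs]
    have h : ContDiff ℝ (⊤ : ℕ∞) (fun s' => φ s' t x) :=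
      hφ.comp (contDiff_id.prodMk (contDiff_const (c := (t, x))))
    exact (h.differentiable (by simp) s).hasDerivAt
  have hφt : HasDerivAt (fun t' => φ s t' x) (u s t (φ s t x)) t := by
    rw [← ht]
    have h : ContDiff ℝ (⊤ : ℕ∞) (fun t' => φ s t' x) :=
      hφ.comp (contDiff_const.prodMk (contDiff_id.prodMk contDiff_const))
    exact (h.differentiable (by simp) t).hasDerivAt
  have hu' : ContDiff ℝ (⊤ : ℕ∞) (fun p : ℝ × (Fin n → ℝ) => u p.1 t p.2) :=
    hu.comp (contDiff_fst.prodMk (contDiff_const.prodMk contDiff_snd))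
  have hv' : ContDiff ℝ (⊤ : ℕ∞) (fun p : ℝ × (Fin n → ℝ) => v s p.1 p.2) :=
    hv.comp (contDiff_const.prodMk contDiff_id)
  have hφ' : ContDiff ℝ (⊤ : ℕ∞) (fun p : ℝ × ℝ => φ p.1 p.2 x) :=
    hφ.comp (contDiff_fst.prodMk (contDiff_snd.prodMk contDiff_const))
  have hcomm := deriv_deriv_comm_of_contDiff (f := fun s' t' => φ s' t' x)
    (hφ'.of_le (WithTop.coe_le_coe.mpr le_top)) s t
  simp only [ht, hs] at hcomm
  rw [(hasDerivAt_comp_curve (w := fun s' => u s' t) (hu'.differentiable (by simp) _) hφs).deriv,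
    (hasDerivAt_comp_curve (w := v s) (hv'.differentiable (by simp) _) hφt).deriv] at hcomm
  exact eq_sub_of_add_eq hcomm
end

section
/- Let d, N ≥ 1. Consider the configuration space Q := (Fin N → ℝᵈ) × (Fin N → Matrix (Fin d) (Fin d) ℝ), with elements (x, A), and let L : Q × Q → ℝ be C^∞ (a Lagrangian in positions (x, A) and velocities (ẋ, Ȧ)). Suppose L is invariant under the right action of SL(d,ℝ)^N on the frame components: for every B : Fin N → Matrix (Fin d) (Fin d) ℝ with det (B i) = 1 for all i, and all (x, A, ẋ, Ȧ), one has L((x, fun i => A i * B i), (ẋ, fun i => Ȧ i * B i)) = L((x, A), (ẋ, Ȧ)). Let t ↦ (x t, A t) be a C² curve in Q satisfying the Euler–Lagrange equations for L, i.e., with p(t) := D₂L((x t, A t), (x' t, A' t)) ∈ (Q →L[ℝ] ℝ) the velocity-slot Fréchet derivative, t ↦ p(t) is differentiable and p'(t) = D₁L((x t, A t), (x' t, A' t)) for all t. Then for every ω : Fin N → Matrix (Fin d) (Fin d) ℝ with trace (ω i) = 0 for all i, the function t ↦ p(t)(0, fun i => A i t * ω i) is constant. -/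
attribute [local instance] Matrix.normedAddCommGroup Matrix.normedSpace

theorem Matrix.hasDerivAt_det_one_add_smul {n : Type*} [Fintype n] [DecidableEq n]
    (M : Matrix n n ℝ) : HasDerivAt (fun s : ℝ => (1 + s • M).det) M.trace 0 := by
  rw [funext fun s => Matrix.det_one_add_smul s M]
  have h := (((hasDerivAt_id (0 : ℝ)).const_mul M.trace).const_add 1).add
    (((Matrix.det (1 + (Polynomial.X : Polynomial ℝ) •
      M.map Polynomial.C)).divX.divX.hasDerivAt 0).mul (hasDerivAt_pow 2 (0 : ℝ)))
  convert! h using 1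
  simp

/-- A traceless matrix is the velocity at the identity of a curve of matrices which have
determinant one for small times. -/
theorem Matrix.exists_hasDerivAt_det_eq_one {n : Type*} [Fintype n] [DecidableEq n] [Nonempty n]
    {M : Matrix n n ℝ} (hM : M.trace = 0) :
    ∃ B : ℝ → Matrix n n ℝ, B 0 = 1 ∧ HasDerivAt B M 0 ∧
      ∀ᶠ s in nhds (0 : ℝ), (B s).det = 1 := by
  have hdet := M.hasDerivAt_det_one_add_smul
  rw [hM] at hdet
  have hscale : HasDerivAt
      (fun s : ℝ => (1 + s • M).det ^ (-(Fintype.card n : ℝ)⁻¹)) 0 0 := by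
    simpa using hdet.rpow_const (p := -(Fintype.card n : ℝ)⁻¹) (Or.inl (by simp))
  have hline : HasDerivAt (fun s : ℝ => (1 : Matrix n n ℝ) + s • M) M 0 := by
    have h := (hasDerivAt_id (0 : ℝ)).smul_const M
    rw [one_smul] at h
    exact h.const_add 1
  refine ⟨fun s => (1 + s • M).det ^ (-(Fintype.card n : ℝ)⁻¹) • (1 + s • M), by simp, ?_, ?_⟩
  · have h := hscale.smul hline
    simp only [zero_smul, add_zero, Matrix.det_one, Real.one_rpow, one_smul] at h
    exact h
  · have hpos : ∀ᶠ s in nhds (0 : ℝ), 0 < (1 + s • M).det :=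
      hdet.continuousAt.eventually (lt_mem_nhds (by simp))
    filter_upwards [hpos] with s hs
    rw [Matrix.det_smul, ← Real.rpow_natCast, ← Real.rpow_mul hs.le, neg_mul,
      inv_mul_cancel₀ (Nat.cast_ne_zero.mpr Fintype.card_ne_zero), Real.rpow_neg_one,
      inv_mul_cancel₀ hs.ne']

theorem HasDerivAt.matrix_const_mul {n : Type*} [Fintype n] (A : Matrix n n ℝ)
    {B : ℝ → Matrix n n ℝ} {B' : Matrix n n ℝ} {t : ℝ} (hB : HasDerivAt B B' t) :
    HasDerivAt (fun s => A * B s) (A * B') t :=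
  (LinearMap.mulLeft ℝ A).toContinuousLinearMap.hasFDerivAt.comp_hasDerivAt t hB

theorem HasDerivAt.matrix_mul_const {n : Type*} [Fintype n] {A : ℝ → Matrix n n ℝ}
    {A' : Matrix n n ℝ} {t : ℝ} (hA : HasDerivAt A A' t) (B : Matrix n n ℝ) :
    HasDerivAt (fun s => A s * B) (A' * B) t :=
  (LinearMap.mulRight ℝ B).toContinuousLinearMap.hasFDerivAt.comp_hasDerivAt t hA

/-- The infinitesimal form of invariance under the right action of unimodular matrices. -/
theorem fderiv_eq_zero_of_unimodular_invariant {ι n E F : Type*} [Fintype ι] [Fintype n]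
    [DecidableEq n] [Nonempty n] [NormedAddCommGroup E] [NormedSpace ℝ E]
    [NormedAddCommGroup F] [NormedSpace ℝ F]
    {L : (E × (ι → Matrix n n ℝ)) × (F × (ι → Matrix n n ℝ)) → ℝ}
    (hL : Differentiable ℝ L)
    (hinv : ∀ B : ι → Matrix n n ℝ, (∀ i, (B i).det = 1) → ∀ x A x' A',
      L ((x, fun i => A i * B i), (x', fun i => A' i * B i)) = L ((x, A), (x', A')))
    {ω : ι → Matrix n n ℝ} (hω : ∀ i, (ω i).trace = 0)
    (q : E × (ι → Matrix n n ℝ)) (v : F × (ι → Matrix n n ℝ)) :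
    fderiv ℝ L (q, v) ((0, fun i => q.2 i * ω i), (0, fun i => v.2 i * ω i)) = 0 := by
  choose B hB0 hB hBdet using fun i => Matrix.exists_hasDerivAt_det_eq_one (hω i)
  have hcurve (A : ι → Matrix n n ℝ) :
      HasDerivAt (fun s i => A i * B i s) (fun i => A i * ω i) 0 :=
    hasDerivAt_pi.2 fun i => (hB i).matrix_const_mul (A i)
  have hLcurve := (hL ((q.1, fun i => q.2 i * B i 0), (v.1, fun i => v.2 i * B i 0))
    ).hasFDerivAt.comp_hasDerivAt (0 : ℝ)
      (((hasDerivAt_const (0 : ℝ) q.1).prodMk (hcurve q.2)).prodMk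
        ((hasDerivAt_const (0 : ℝ) v.1).prodMk (hcurve v.2)))
  simp only [hB0, mul_one] at hLcurve
  refine hLcurve.unique ((hasDerivAt_const (0 : ℝ) (L (q, v))).congr_of_eventuallyEq ?_)
  filter_upwards [Filter.eventually_all.2 hBdet] with s hs
  exact hinv (fun i => B i s) hs q.1 q.2 v.1 v.2

/-- Noether's theorem along a solution of the Euler–Lagrange equations: the momentum in a
direction `ξ` along which the Lagrangian is infinitesimally invariant is conserved. -/
theorem momentum_eq_of_infinitesimal_invariance {E : Type*} [NormedAddCommGroup E]
    [NormedSpace ℝ E] {L : E × E → ℝ} (hL : Differentiable ℝ L) {c : ℝ → E} {p : ℝ → E →L[ℝ] ℝ}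
    (hp : ∀ t, p t = fderiv ℝ (fun v => L (c t, v)) (deriv c t)) (hpdiff : Differentiable ℝ p)
    (hEL : ∀ t, deriv p t = fderiv ℝ (fun x => L (x, deriv c t)) (c t))
    {ξ ξ' : ℝ → E} (hξ : ∀ t, HasDerivAt ξ (ξ' t) t)
    (hinv : ∀ t, fderiv ℝ L (c t, deriv c t) (ξ t, ξ' t) = 0) (t₁ t₂ : ℝ) :
    p t₁ (ξ t₁) = p t₂ (ξ t₂) := by
  have hderiv (t : ℝ) : HasDerivAt (fun t => p t (ξ t)) 0 t := by
    have h := (hpdiff t).hasDerivAt.clm_apply (hξ t)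
    have hvel : HasFDerivAt (fun v => L (c t, v)) _ (deriv c t) :=
      (hL (c t, deriv c t)).hasFDerivAt.comp (deriv c t) (hasFDerivAt_prodMk_right _ _)
    have hpos : HasFDerivAt (fun x => L (x, deriv c t)) _ (c t) :=
      (hL (c t, deriv c t)).hasFDerivAt.comp (c t) (hasFDerivAt_prodMk_left _ _)
    rw [hEL] at h
    convert! h using 1
    rw [hp, hvel.fderiv, hpos.fderiv, ← hinv t]
    simp [← map_add]
  exact is_const_of_deriv_eq_zero (fun t => (hderiv t).differentiableAt)
    (fun t => (hderiv t).deriv) t₁ t₂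

/-- Theorem 5.3 (particle-centric Kelvin circulation theorem) for `k = 1`, `M = ℝᵈ`: for a
Lagrangian on the configuration space `(ℝᵈ)^N × SL(d,ℝ)^N` of particles with frames which is
invariant under the right `SL(d,ℝ)^N` action on the frames, the momenta conjugate to the spin
and rate of stretching (generated by tuples of traceless matrices `ω`) are conserved along
solutions of the Euler–Lagrange equations. -/
theorem stmt13 {d N : ℕ} (hd : 1 ≤ d) (hN : 1 ≤ N)
    (L : ((Fin N → (Fin d → ℝ)) × (Fin N → Matrix (Fin d) (Fin d) ℝ)) ×
         ((Fin N → (Fin d → ℝ)) × (Fin N → Matrix (Fin d) (Fin d) ℝ)) → ℝ)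
    (hL : ContDiff ℝ (⊤ : ℕ∞) L)
    (hinv : ∀ (B : Fin N → Matrix (Fin d) (Fin d) ℝ), (∀ i, (B i).det = 1) →
      ∀ (x : Fin N → (Fin d → ℝ)) (A : Fin N → Matrix (Fin d) (Fin d) ℝ)
        (x' : Fin N → (Fin d → ℝ)) (A' : Fin N → Matrix (Fin d) (Fin d) ℝ),
        L ((x, fun i => A i * B i), (x', fun i => A' i * B i)) = L ((x, A), (x', A')))
    (c : ℝ → (Fin N → (Fin d → ℝ)) × (Fin N → Matrix (Fin d) (Fin d) ℝ))
    (hc : ContDiff ℝ 2 c)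
    (p : ℝ → (((Fin N → (Fin d → ℝ)) × (Fin N → Matrix (Fin d) (Fin d) ℝ)) →L[ℝ] ℝ))
    (hp : ∀ t, p t = fderiv ℝ (fun v => L (c t, v)) (deriv c t))
    (hpdiff : Differentiable ℝ p)
    (hEL : ∀ t, deriv p t = fderiv ℝ (fun x => L (x, deriv c t)) (c t)) :
    ∀ (ω : Fin N → Matrix (Fin d) (Fin d) ℝ), (∀ i, (ω i).trace = 0) →
      ∀ t₁ t₂ : ℝ,
        (p t₁) (0, fun i => (c t₁).2 i * ω i) = (p t₂) (0, fun i => (c t₂).2 i * ω i) := by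
  intro ω hω
  have : Nonempty (Fin d) := ⟨⟨0, hd⟩⟩
  have hLd : Differentiable ℝ L := hL.differentiable (by simp)
  have hcd : Differentiable ℝ c := hc.differentiable (by simp)
  have hframe (t : ℝ) : HasDerivAt (fun t i => (c t).2 i * ω i)
      (fun i => (deriv c t).2 i * ω i) t :=
    hasDerivAt_pi.2 fun i =>
      (hasDerivAt_pi.1 (hcd t).hasDerivAt.snd i).matrix_mul_const (ω i)
  exact momentum_eq_of_infinitesimal_invariance hLd hp hpdiff hEL
    (fun t => (hasDerivAt_const t (0 : Fin N → Fin d → ℝ)).prodMk (hframe t))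
    fun t => fderiv_eq_zero_of_unimodular_invariant hLd hinv hω (c t) (deriv c t)
end

section
/- Let n ≥ 1, k ≥ 1, a ∈ ℝⁿ, and let φ : ℝⁿ → ℝⁿ be C^∞. Then the following are equivalent: (i) for every C^∞ curve c : ℝ → ℝⁿ with c 0 = a and every 0 ≤ j ≤ k, iteratedDeriv j (φ ∘ c) 0 = iteratedDeriv j c 0; (ii) φ(a) = a, fderiv ℝ φ a is the identity continuous linear map, and iteratedFDeriv ℝ j φ a = 0 for all 2 ≤ j ≤ k. -/
section SymmetricDerivatives

variable {E F : Type*} [NormedAddCommGroup E] [NormedSpace ℝ E]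
  [NormedAddCommGroup F] [NormedSpace ℝ F]

/-- The iterated directional derivative of `f` along the vectors of a list, the last vector of
the list being the first direction of differentiation. -/
noncomputable def listFDeriv (f : E → F) (l : List E) : E → F :=
  l.foldr (fun v g x => fderiv ℝ g x v) f

theorem listFDeriv_cons (f : E → F) (v : E) (l : List E) :
    listFDeriv f (v :: l) = fun x => fderiv ℝ (listFDeriv f l) x v := rfl

theorem ContDiff.contDiff_listFDeriv {f : E → F} (hf : ContDiff ℝ (⊤ : ℕ∞) f) (l : List E) :
    ContDiff ℝ (⊤ : ℕ∞) (listFDeriv f l) := by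
  induction l with
  | nil => exact hf
  | cons v l ih =>
    rw [listFDeriv_cons]
    exact (ih.fderiv_right (by simp)).clm_apply contDiff_const

theorem ContDiff.fderiv_fderiv_comm {f : E → F} (hf : ContDiff ℝ (⊤ : ℕ∞) f) (v w x : E) :
    fderiv ℝ (fun y => fderiv ℝ f y w) x v = fderiv ℝ (fun y => fderiv ℝ f y v) x w := by
  have hd : DifferentiableAt ℝ (fderiv ℝ f) x :=
    ((hf.fderiv_right (m := (⊤ : ℕ∞)) (by simp)).differentiable (by simp)).differentiableAt
  have hs : IsSymmSndFDerivAt ℝ f x :=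
    hf.contDiffAt.isSymmSndFDerivAt (by
      rw [minSmoothness_of_isRCLikeNormedField]
      exact WithTop.coe_le_coe.2 (le_top : (2 : ℕ∞) ≤ ⊤))
  simp [fderiv_clm_apply hd (differentiableAt_const _), hs.eq v w]

theorem ContDiff.listFDeriv_perm {f : E → F} (hf : ContDiff ℝ (⊤ : ℕ∞) f) {l₁ l₂ : List E}
    (h : l₁.Perm l₂) : listFDeriv f l₁ = listFDeriv f l₂ := by
  induction h with
  | nil => rfl
  | cons v _ ih => rw [listFDeriv_cons, listFDeriv_cons, ih]
  | swap v w l =>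
    funext x
    exact (hf.contDiff_listFDeriv l).fderiv_fderiv_comm w v x
  | trans _ _ ih₁ ih₂ => exact ih₁.trans ih₂

theorem ContDiff.iteratedFDeriv_eq_listFDeriv {f : E → F} (hf : ContDiff ℝ (⊤ : ℕ∞) f) {j : ℕ}
    (m : Fin j → E) (x : E) :
    iteratedFDeriv ℝ j f x m = listFDeriv f (List.ofFn m) x := by
  induction j generalizing x with
  | zero => simp [listFDeriv]
  | succ j ih =>
    have hd : DifferentiableAt ℝ (iteratedFDeriv ℝ j f) x :=
      (hf.differentiable_iteratedFDeriv (by exact_mod_cast WithTop.coe_lt_top j)).differentiableAt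
    rw [List.ofFn_succ, listFDeriv_cons, iteratedFDeriv_succ_apply_left]
    simp only [← funext (ih fun i => m i.succ)]
    rw [fderiv_continuousMultilinear_apply_const_apply hd]
    rfl

/-- The iterated derivatives of a smooth real map are symmetric. -/
theorem ContDiff.iteratedFDeriv_perm {f : E → F} (hf : ContDiff ℝ (⊤ : ℕ∞) f) {j : ℕ}
    (m : Fin j → E) (σ : Equiv.Perm (Fin j)) (x : E) :
    iteratedFDeriv ℝ j f x (fun i => m (σ i)) = iteratedFDeriv ℝ j f x m := by
  rw [hf.iteratedFDeriv_eq_listFDeriv, hf.iteratedFDeriv_eq_listFDeriv]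
  exact congrFun (hf.listFDeriv_perm (σ.ofFn_comp_perm m)) x

/-- A symmetric continuous multilinear map vanishing on the diagonal is zero. -/
theorem ContinuousMultilinearMap.eq_zero_of_diagonal {j : ℕ} (p : E [×j]→L[ℝ] F)
    (hsymm : ∀ (m : Fin j → E) (σ : Equiv.Perm (Fin j)), p (fun i => m (σ i)) = p m)
    (hdiag : ∀ v : E, p (fun _ => v) = 0) : p = 0 := by
  ext m
  have h := p.iteratedFDeriv_comp_diagonal 0 m
  simp only [hdiag, hsymm, Finset.sum_const, Finset.card_univ, Fintype.card_perm,
    Fintype.card_fin, iteratedFDeriv_fun_zero] at h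
  have h' : (j.factorial : ℝ) • p m = 0 := by
    rw [Nat.cast_smul_eq_nsmul]
    exact h.symm
  simpa [j.factorial_ne_zero] using h'

theorem ContDiff.iteratedDeriv_comp_line {f : E → F} (hf : ContDiff ℝ (⊤ : ℕ∞) f) (a v : E)
    (j : ℕ) :
    iteratedDeriv j (f ∘ fun t : ℝ => a + t • v) 0 = iteratedFDeriv ℝ j f a (fun _ => v) := by
  have hg : ContDiff ℝ (⊤ : ℕ∞) (fun y => f (a + y)) := hf.comp (contDiff_const.add contDiff_id)
  have h := (ContinuousLinearMap.toSpanSingleton ℝ v).iteratedFDeriv_comp_right hg 0 (i := j)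
    (by exact_mod_cast le_top)
  have he : (f ∘ fun t : ℝ => a + t • v) =
      (fun y => f (a + y)) ∘ ContinuousLinearMap.toSpanSingleton ℝ v := rfl
  rw [iteratedDeriv_eq_iteratedFDeriv, he, h]
  simp [iteratedFDeriv_comp_add_left]

/-- A smooth map is flat to order `k` at `a` if and only if its composition with every smooth
curve through `a` is flat to order `k`. -/
theorem ContDiff.iteratedDeriv_comp_eq_zero_iff {f : E → F} (hf : ContDiff ℝ (⊤ : ℕ∞) f) (a : E)
    (k : ℕ) :
    (∀ c : ℝ → E, ContDiff ℝ (⊤ : ℕ∞) c → c 0 = a →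
        ∀ j : ℕ, j ≤ k → iteratedDeriv j (f ∘ c) 0 = 0) ↔
      ∀ j : ℕ, j ≤ k → iteratedFDeriv ℝ j f a = 0 := by
  constructor
  · intro h j hj
    refine ContinuousMultilinearMap.eq_zero_of_diagonal _
      (fun m σ => hf.iteratedFDeriv_perm m σ a) fun v => ?_
    rw [← hf.iteratedDeriv_comp_line]
    exact h _ (contDiff_const.add (contDiff_id.smul contDiff_const)) (by simp) j hj
  · rintro h c hc rfl j hj
    rw [iteratedDeriv_vcomp_eq_sum_orderedFinpartition hf.contDiffAt hc.contDiffAt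
      (by exact_mod_cast le_top)]
    refine Finset.sum_eq_zero fun p _ => ?_
    simp [h p.length (p.length_le.trans hj)]

theorem iteratedFDeriv_id_eq_zero {j : ℕ} (hj : 2 ≤ j) (x : E) :
    iteratedFDeriv ℝ j (id : E → E) x = 0 := by
  obtain ⟨j, rfl⟩ := Nat.exists_eq_add_of_le' hj
  ext m
  have h : fderiv ℝ (id : E → E) = fun _ => ContinuousLinearMap.id ℝ E := funext fun _ => fderiv_id
  rw [iteratedFDeriv_succ_apply_right, h, iteratedFDeriv_succ_const]
  simp

theorem ContDiff.iteratedFDeriv_sub_id_eq_zero_iff {f : E → E} (hf : ContDiff ℝ (⊤ : ℕ∞) f)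
    (a : E) {k : ℕ} (hk : 1 ≤ k) :
    (∀ j : ℕ, j ≤ k → iteratedFDeriv ℝ j (f - id) a = 0) ↔
      (f a = a ∧ fderiv ℝ f a = ContinuousLinearMap.id ℝ E ∧
        ∀ j : ℕ, 2 ≤ j → j ≤ k → iteratedFDeriv ℝ j f a = 0) := by
  have hsub (j : ℕ) : iteratedFDeriv ℝ j (f - id) a =
      iteratedFDeriv ℝ j f a - iteratedFDeriv ℝ j id a :=
    iteratedFDeriv_sub_apply (hf.of_le (by exact_mod_cast le_top)).contDiffAt contDiffAt_id
  have h0 : iteratedFDeriv ℝ 0 (f - id) a = 0 ↔ f a = a := by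
    simp [ContinuousMultilinearMap.ext_iff, sub_eq_zero]
  have h1 : iteratedFDeriv ℝ 1 (f - id) a = 0 ↔ fderiv ℝ f a = ContinuousLinearMap.id ℝ E := by
    rw [hsub, sub_eq_zero]
    constructor
    · intro h
      ext v
      simpa using congrArg (fun p => p (fun _ => v)) h
    · intro h
      ext m
      simp [h]
  have h2 (j : ℕ) (hj : 2 ≤ j) :
      iteratedFDeriv ℝ j (f - id) a = 0 ↔ iteratedFDeriv ℝ j f a = 0 := by
    rw [hsub, iteratedFDeriv_id_eq_zero hj, sub_zero]
  constructor
  · exact fun h => ⟨h0.1 (h 0 k.zero_le), h1.1 (h 1 hk), fun j hj hjk => (h2 j hj).1 (h j hjk)⟩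
  · rintro ⟨e0, e1, e2⟩ j hjk
    match j with
    | 0 => exact h0.2 e0
    | 1 => exact h1.2 e1
    | j + 2 => exact (h2 _ (by omega)).2 (e2 _ (by omega) hjk)

end SymmetricDerivatives


/-- Section 4.1: a smooth map `φ` acts as the identity on `k`-th order tangent data at `a`
(it preserves the `k`-th order jet of every smooth curve through `a`) if and only if
`φ a = a`, `Dφ(a) = id`, and all higher derivatives of `φ` at `a` up to order `k` vanish. -/
theorem stmt15 {n k : ℕ} (hn : 1 ≤ n) (hk : 1 ≤ k) (a : Fin n → ℝ)
    (φ : (Fin n → ℝ) → (Fin n → ℝ)) (hφ : ContDiff ℝ (⊤ : ℕ∞) φ) :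
    (∀ c : ℝ → (Fin n → ℝ), ContDiff ℝ (⊤ : ℕ∞) c → c 0 = a →
        ∀ j : ℕ, j ≤ k → iteratedDeriv j (φ ∘ c) 0 = iteratedDeriv j c 0) ↔
      (φ a = a ∧ fderiv ℝ φ a = ContinuousLinearMap.id ℝ (Fin n → ℝ) ∧
        ∀ j : ℕ, 2 ≤ j → j ≤ k → iteratedFDeriv ℝ j φ a = 0) := by
  have hψ : ContDiff ℝ (⊤ : ℕ∞) (φ - id) := hφ.sub contDiff_id
  rw [← hφ.iteratedFDeriv_sub_id_eq_zero_iff a hk, ← hψ.iteratedDeriv_comp_eq_zero_iff a k]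
  refine forall_congr' fun c => forall_congr' fun hc => forall_congr' fun _ =>
    forall_congr' fun j => forall_congr' fun _ => ?_
  have hj : ((j : ℕ∞) : WithTop ℕ∞) ≤ (⊤ : ℕ∞) := by exact_mod_cast le_top
  have h : (φ - id) ∘ c = φ ∘ c - c := rfl
  rw [h, iteratedDeriv_sub ((hφ.comp hc).of_le hj).contDiffAt (hc.of_le hj).contDiffAt,
    sub_eq_zero]
end
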